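/- arXiv:1507.02728 — 2 statements merged into one kernel-verified Lean document; each statement's English description precedes it below -/
import Mathlib

section
/- The action of the semigroup Γ̄ on AC_0([0,1],ℝ^d) by composition is jointly continuous: if c_n → c in AC_0([0,1],ℝ^d) and γ_n → γ in Γ̄ (i.e. ∫_0^1 |γ_n' − γ'| dt → 0), then c_n ∘ γ_n → c ∘ γ in AC_0([0,1],ℝ^d). -/
open MeasureTheory Set Filter
open scoped NNReal ENNReal

noncomputable section

/-- `ℝ^d` with the Euclidean norm. -/
abbrev E (d : ℕ) := EuclideanSpace ℝ (Fin d)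

/-- `V x = x / √|x|`, with `V 0 = 0` (note `Real.sqrt 0 = 0` and `0⁻¹ = 0`). -/
def V {d : ℕ} (x : E d) : E d := (Real.sqrt ‖x‖)⁻¹ • x

/-- `c` is an absolutely continuous curve on `[0,1]` with `c 0 = 0` and a.e. derivative `f`,
i.e. `c t = ∫_0^t f` on `[0,1]` with `f` integrable. -/
def IsACDeriv {d : ℕ} (c f : ℝ → E d) : Prop :=
  StronglyMeasurable f ∧ IntegrableOn f (Icc 0 1) volume ∧
    ∀ t ∈ Icc (0:ℝ) 1, c t = ∫ τ in (0:ℝ)..t, f τ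

/-- Scalar version: `γ t = ∫_0^t g` on `[0,1]` with `g` integrable. -/
def IsACDerivR (γ g : ℝ → ℝ) : Prop :=
  StronglyMeasurable g ∧ IntegrableOn g (Icc 0 1) volume ∧
    ∀ t ∈ Icc (0:ℝ) 1, γ t = ∫ τ in (0:ℝ)..t, g τ

/-- The semigroup `Γ̄` of absolutely continuous `γ : [0,1] → [0,1]` with
`γ 0 = 0`, `γ 1 = 1` and `γ' ≥ 0` a.e. -/
def MemGammaBar (γ : ℝ → ℝ) : Prop :=
  ∃ g, IsACDerivR γ g ∧ (∀ᵐ t ∂(volume.restrict (Icc (0:ℝ) 1)), 0 ≤ g t) ∧ γ 1 = 1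

/-- The group `Γ` of absolutely continuous `γ : [0,1] → [0,1]` with
`γ 0 = 0`, `γ 1 = 1` and `γ' > 0` a.e. -/
def MemGamma (γ : ℝ → ℝ) : Prop :=
  ∃ g, IsACDerivR γ g ∧ (∀ᵐ t ∂(volume.restrict (Icc (0:ℝ) 1)), 0 < g t) ∧ γ 1 = 1

namespace IsACDerivR

variable {γ g : ℝ → ℝ}

theorem zero (hγ : IsACDerivR γ g) : γ 0 = 0 := by
  simpa using hγ.2.2 0 (by simp)

theorem eq_setIntegral (hγ : IsACDerivR γ g) {t : ℝ} (ht : t ∈ Icc (0 : ℝ) 1) :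
    γ t = ∫ τ in Icc 0 t, g τ := by
  rw [hγ.2.2 t ht, intervalIntegral.integral_of_le ht.1, integral_Icc_eq_integral_Ioc]

theorem continuousOn (hγ : IsACDerivR γ g) : ContinuousOn γ (Icc 0 1) := by
  refine ContinuousOn.congr ?_ hγ.2.2
  have h := intervalIntegral.continuousOn_primitive_interval (μ := volume) (f := g)
    (a := 0) (b := 1) (by simpa using hγ.2.1)
  simpa using h

theorem aemeasurable (hγ : IsACDerivR γ g) : AEMeasurable γ (volume.restrict (Icc 0 1)) :=
  hγ.continuousOn.aemeasurable measurableSet_Icc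

theorem withDensity_Icc (hγ : IsACDerivR γ g)
    (h0 : ∀ᵐ t ∂(volume.restrict (Icc (0:ℝ) 1)), 0 ≤ g t) {t : ℝ} (ht : t ∈ Icc (0 : ℝ) 1) :
    ∫⁻ τ in Icc 0 t, ENNReal.ofReal (g τ) = ENNReal.ofReal (γ t) := by
  have hsub : Icc 0 t ⊆ Icc (0 : ℝ) 1 := Icc_subset_Icc_right ht.2
  rw [hγ.eq_setIntegral ht, ofReal_integral_eq_lintegral_ofReal (hγ.2.1.mono_set hsub)
    (ae_restrict_of_ae_restrict_of_subset hsub h0)]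

theorem monotoneOn (hγ : IsACDerivR γ g)
    (h0 : ∀ᵐ t ∂(volume.restrict (Icc (0:ℝ) 1)), 0 ≤ g t) : MonotoneOn γ (Icc 0 1) := by
  intro s hs t ht hst
  rw [hγ.eq_setIntegral hs, hγ.eq_setIntegral ht]
  have hsub : Icc 0 t ⊆ Icc (0 : ℝ) 1 := Icc_subset_Icc_right ht.2
  exact setIntegral_mono_set (hγ.2.1.mono_set hsub)
    (ae_restrict_of_ae_restrict_of_subset hsub h0) (Icc_subset_Icc_right hst).eventuallyLE

theorem mapsTo (hγ : IsACDerivR γ g)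
    (h0 : ∀ᵐ t ∂(volume.restrict (Icc (0:ℝ) 1)), 0 ≤ g t) (h1 : γ 1 = 1) :
    MapsTo γ (Icc 0 1) (Icc 0 1) := by
  intro t ht
  refine ⟨?_, ?_⟩
  · rw [← hγ.zero]
    exact hγ.monotoneOn h0 (by simp) ht ht.1
  · rw [← h1]
    exact hγ.monotoneOn h0 ht (by simp) ht.2

/-- Change of variables: `γ` pushes the measure `γ' dt` on `[0,t]` to Lebesgue measure
on `[0, γ t]`. -/
theorem map_withDensity (hγ : IsACDerivR γ g)
    (h0 : ∀ᵐ t ∂(volume.restrict (Icc (0:ℝ) 1)), 0 ≤ g t) {t : ℝ} (ht : t ∈ Icc (0 : ℝ) 1) :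
    ((volume.restrict (Icc 0 t)).withDensity fun τ => ENNReal.ofReal (g τ)).map γ =
      volume.restrict (Icc 0 (γ t)) := by
  have hsub : Icc 0 t ⊆ Icc (0 : ℝ) 1 := Icc_subset_Icc_right ht.2
  have hmono := hγ.monotoneOn h0
  have hcont : ContinuousOn γ (Icc 0 t) := hγ.continuousOn.mono hsub
  have hmeas : AEMeasurable γ
      ((volume.restrict (Icc 0 t)).withDensity fun τ => ENNReal.ofReal (g τ)) :=
    (hcont.aemeasurable measurableSet_Icc).mono_ac (withDensity_absolutelyContinuous _ _)
  symm
  refine Measure.ext_of_Iic _ _ fun a => ?_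
  have hS : IsClosed (Icc 0 t ∩ γ ⁻¹' Iic a) := hcont.preimage_isClosed_of_isClosed isClosed_Icc
    isClosed_Iic
  have hset : Iic a ∩ Icc 0 (γ t) = Icc 0 (min a (γ t)) := by
    ext x
    simp only [mem_inter_iff, mem_Iic, mem_Icc, le_min_iff]
    tauto
  have hpre : ((volume.restrict (Icc 0 t)).withDensity fun τ => ENNReal.ofReal (g τ)) (γ ⁻¹' Iic a)
      = ∫⁻ τ in Icc 0 t ∩ γ ⁻¹' Iic a, ENNReal.ofReal (g τ) := by
    rw [withDensity_apply' _ _, Measure.restrict_restrict' measurableSet_Icc, inter_comm]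
  rw [Measure.map_apply_of_aemeasurable hmeas measurableSet_Iic, hpre,
    Measure.restrict_apply measurableSet_Iic, hset, Real.volume_Icc, sub_zero]
  rcases lt_or_ge a 0 with ha | ha
  · have hempty : Icc 0 t ∩ γ ⁻¹' Iic a = ∅ := by
      refine eq_empty_of_forall_notMem fun s hs => ?_
      have h : γ 0 ≤ γ s := hmono (by simp) (hsub hs.1) hs.1.1
      rw [hγ.zero] at h
      exact absurd (h.trans hs.2) ha.not_ge
    rw [hempty, ENNReal.ofReal_of_nonpos ((min_le_left _ _).trans ha.le)]
    simp
  · obtain ⟨s, ⟨hst, hsa⟩, hgreatest⟩ := (isCompact_Icc.of_isClosed_subset hS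
      inter_subset_left).exists_isGreatest ⟨0, by simp [ht.1], by simpa [hγ.zero] using ha⟩
    have heq : Icc 0 t ∩ γ ⁻¹' Iic a = Icc 0 s := by
      ext u
      refine ⟨fun hu => ⟨hu.1.1, hgreatest hu⟩, fun hu => ⟨⟨hu.1, hu.2.trans hst.2⟩, ?_⟩⟩
      exact (hmono ⟨hu.1, hu.2.trans (hsub hst).2⟩ (hsub hst) hu.2).trans hsa
    rw [heq, hγ.withDensity_Icc h0 (hsub hst)]
    congr 1
    rcases le_total (γ t) a with hta | hat
    · have hts : t ≤ s := hgreatest ⟨⟨ht.1, le_rfl⟩, hta⟩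
      rw [min_eq_right hta, le_antisymm hst.2 hts]
    · rw [min_eq_left hat]
      obtain ⟨u, hu, hua⟩ := intermediate_value_Icc hst.2
        (hcont.mono (Icc_subset_Icc_left hst.1)) ⟨hsa, hat⟩
      have hus : u ≤ s := hgreatest ⟨⟨hst.1.trans hu.1, hu.2⟩, hua.le⟩
      rw [← hua, le_antisymm hus hu.1]

theorem lintegral_enorm_smul_comp {d : ℕ} (hγ : IsACDerivR γ g)
    (h0 : ∀ᵐ t ∂(volume.restrict (Icc (0:ℝ) 1)), 0 ≤ g t) (h1 : γ 1 = 1)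
    {φ : ℝ → E d} (hφ : Measurable φ) :
    ∫⁻ t in Icc (0:ℝ) 1, ‖g t • φ (γ t)‖ₑ = ∫⁻ t in Icc (0:ℝ) 1, ‖φ t‖ₑ := by
  have hmap := hγ.map_withDensity h0 (t := 1) (by simp)
  rw [h1] at hmap
  have hγm := hγ.aemeasurable
  have hg : Measurable fun τ => ENNReal.ofReal (g τ) := hγ.1.measurable.ennreal_ofReal
  conv_rhs => rw [← hmap]
  have hφγ : AEMeasurable (fun t => ‖φ (γ t)‖ₑ) (volume.restrict (Icc 0 1)) :=
    hφ.enorm.comp_aemeasurable hγm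
  rw [lintegral_map' hφ.enorm.aemeasurable
      (hγm.mono_ac (withDensity_absolutelyContinuous _ _)),
    lintegral_withDensity_eq_lintegral_mul₀ hg.aemeasurable hφγ]
  refine lintegral_congr_ae ?_
  filter_upwards [h0] with t ht
  simp [enorm_smul, Real.enorm_of_nonneg ht]

theorem aestronglyMeasurable_smul_comp {d : ℕ} (hγ : IsACDerivR γ g)
    {φ : ℝ → E d} (hφ : Measurable φ) :
    AEStronglyMeasurable (fun t => g t • φ (γ t)) (volume.restrict (Icc (0:ℝ) 1)) :=
  hγ.1.aestronglyMeasurable.smul (hφ.comp_aemeasurable hγ.aemeasurable).aestronglyMeasurable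

theorem integrableOn_smul_comp {d : ℕ} (hγ : IsACDerivR γ g)
    (h0 : ∀ᵐ t ∂(volume.restrict (Icc (0:ℝ) 1)), 0 ≤ g t) (h1 : γ 1 = 1)
    {φ : ℝ → E d} (hφ : Measurable φ) (hi : IntegrableOn φ (Icc 0 1)) :
    IntegrableOn (fun t => g t • φ (γ t)) (Icc 0 1) := by
  refine ⟨hγ.aestronglyMeasurable_smul_comp hφ, ?_⟩
  rw [HasFiniteIntegral, hγ.lintegral_enorm_smul_comp h0 h1 hφ]
  exact hi.2

theorem setIntegral_smul_comp {d : ℕ} (hγ : IsACDerivR γ g)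
    (h0 : ∀ᵐ t ∂(volume.restrict (Icc (0:ℝ) 1)), 0 ≤ g t) {t : ℝ} (ht : t ∈ Icc (0 : ℝ) 1)
    {φ : ℝ → E d} (hφ : Measurable φ) :
    ∫ τ in Icc 0 t, g τ • φ (γ τ) = ∫ τ in Icc 0 (γ t), φ τ := by
  have hsub : Icc 0 t ⊆ Icc (0 : ℝ) 1 := Icc_subset_Icc_right ht.2
  have hγm : AEMeasurable γ (volume.restrict (Icc 0 t)) := hγ.aemeasurable.mono_set hsub
  rw [← hγ.map_withDensity h0 ht,
    integral_map (hγm.mono_ac (withDensity_absolutelyContinuous _ _))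
      hφ.aestronglyMeasurable,
    integral_withDensity_eq_integral_toReal_smul hγ.1.measurable.ennreal_ofReal (by simp)]
  refine integral_congr_ae ?_
  filter_upwards [ae_restrict_of_ae_restrict_of_subset hsub h0] with s hs
  simp [ENNReal.toReal_ofReal hs]

end IsACDerivR

/-- Two integrable functions with the same primitive on `[0,1]` agree almost everywhere. -/
theorem ae_eq_of_forall_intervalIntegral_eq {F : Type*} [NormedAddCommGroup F] [NormedSpace ℝ F]
    [CompleteSpace F] {u v : ℝ → F} (hu : IntegrableOn u (Icc 0 1)) (hv : IntegrableOn v (Icc 0 1))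
    (h : ∀ t ∈ Icc (0 : ℝ) 1, ∫ τ in (0:ℝ)..t, u τ = ∫ τ in (0:ℝ)..t, v τ) :
    u =ᵐ[volume.restrict (Icc 0 1)] v := by
  have hu' : IntervalIntegrable u volume 0 1 :=
    (intervalIntegrable_iff_integrableOn_Icc_of_le zero_le_one).2 hu
  have hv' : IntervalIntegrable v volume 0 1 :=
    (intervalIntegrable_iff_integrableOn_Icc_of_le zero_le_one).2 hv
  rw [← Measure.restrict_congr_set Ioo_ae_eq_Icc, EventuallyEq, ae_restrict_iff' measurableSet_Ioo]
  filter_upwards [hu'.ae_hasDerivAt_integral, hv'.ae_hasDerivAt_integral] with x hxu hxv hx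
  rw [uIcc_of_le zero_le_one] at hxu hxv
  have hx' := Ioo_subset_Icc_self hx
  refine (hxu hx' 0 (by simp)).unique ((hxv hx' 0 (by simp)).congr_of_eventuallyEq ?_)
  filter_upwards [Ioo_mem_nhds hx.1 hx.2] with t ht
  exact h t (Ioo_subset_Icc_self ht)

/-- The chain rule `(c ∘ γ)' = γ' • (c' ∘ γ)` almost everywhere. -/
theorem IsACDeriv.comp_ae_eq {d : ℕ} {c f h : ℝ → E d} {γ g : ℝ → ℝ}
    (hh : IsACDeriv (c ∘ γ) h) (hc : IsACDeriv c f) (hγ : IsACDerivR γ g)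
    (h0 : ∀ᵐ t ∂(volume.restrict (Icc (0:ℝ) 1)), 0 ≤ g t) (h1 : γ 1 = 1) :
    h =ᵐ[volume.restrict (Icc 0 1)] fun t => g t • f (γ t) := by
  refine ae_eq_of_forall_intervalIntegral_eq hh.2.1
    (hγ.integrableOn_smul_comp h0 h1 hc.1.measurable hc.2.1) fun t ht => ?_
  have hγt := hγ.mapsTo h0 h1 ht
  rw [← hh.2.2 t ht, Function.comp_apply, hc.2.2 _ hγt, intervalIntegral.integral_of_le ht.1,
    intervalIntegral.integral_of_le hγt.1, ← integral_Icc_eq_integral_Ioc,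
    ← integral_Icc_eq_integral_Ioc, hγ.setIntegral_smul_comp h0 ht hc.1.measurable]

theorem intervalIntegral_norm_eq_toReal {F : Type*} [NormedAddCommGroup F] {u : ℝ → F}
    (hu : AEStronglyMeasurable u (volume.restrict (Icc 0 1))) :
    ∫ t in (0:ℝ)..1, ‖u t‖ = (∫⁻ t in Icc (0:ℝ) 1, ‖u t‖ₑ).toReal := by
  rw [intervalIntegral.integral_of_le zero_le_one, ← integral_Icc_eq_integral_Ioc,
    integral_norm_eq_lintegral_enorm hu]

theorem tendsto_lintegral_enorm_of_tendsto_intervalIntegral {F : Type*} [NormedAddCommGroup F]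
    {u : ℕ → ℝ → F} (hu : ∀ n, IntegrableOn (u n) (Icc 0 1))
    (h : Tendsto (fun n => ∫ t in (0:ℝ)..1, ‖u n t‖) atTop (nhds 0)) :
    Tendsto (fun n => ∫⁻ t in Icc (0:ℝ) 1, ‖u n t‖ₑ) atTop (nhds 0) := by
  rw [← ENNReal.tendsto_toReal_iff (fun n => (hu n).2.ne) ENNReal.zero_ne_top]
  simpa only [intervalIntegral_norm_eq_toReal (hu _).1, ENNReal.toReal_zero] using h

/-- `AC` convergence implies pointwise convergence. -/
theorem IsACDerivR.tendsto_apply {γ g : ℕ → ℝ → ℝ} {γlim glim : ℝ → ℝ}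
    (hγ : ∀ n, IsACDerivR (γ n) (g n)) (hγlim : IsACDerivR γlim glim)
    (hconv : Tendsto (fun n => ∫ t in (0:ℝ)..1, |g n t - glim t|) atTop (nhds 0))
    {t : ℝ} (ht : t ∈ Icc (0 : ℝ) 1) :
    Tendsto (fun n => γ n t) atTop (nhds (γlim t)) := by
  rw [tendsto_iff_norm_sub_tendsto_zero]
  refine squeeze_zero (fun _ => norm_nonneg _) (fun n => ?_) hconv
  have hsub : Icc 0 t ⊆ Icc (0 : ℝ) 1 := Icc_subset_Icc_right ht.2
  have hi : IntegrableOn (fun τ => g n τ - glim τ) (Icc 0 1) := (hγ n).2.1.sub hγlim.2.1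
  rw [(hγ n).eq_setIntegral ht, hγlim.eq_setIntegral ht,
    ← integral_sub ((hγ n).2.1.mono_set hsub) (hγlim.2.1.mono_set hsub),
    intervalIntegral.integral_of_le zero_le_one, ← integral_Icc_eq_integral_Ioc]
  refine (norm_integral_le_integral_norm _).trans ?_
  exact setIntegral_mono_set hi.norm (ae_of_all _ fun _ => norm_nonneg _) hsub.eventuallyLE

/-- Continuity of the action when the curve has a bounded continuous derivative. -/
theorem tendsto_lintegral_smul_comp_of_bounded {d : ℕ} {γ g : ℕ → ℝ → ℝ} {γlim glim : ℝ → ℝ}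
    (hγ : ∀ n, IsACDerivR (γ n) (g n)) (hγlim : IsACDerivR γlim glim)
    (hconv : Tendsto (fun n => ∫ t in (0:ℝ)..1, |g n t - glim t|) atTop (nhds 0))
    {φ : ℝ → E d} (hφ : Continuous φ) {M : ℝ≥0} (hM : ∀ x, ‖φ x‖ₑ ≤ M) :
    Tendsto (fun n => ∫⁻ t in Icc (0:ℝ) 1, ‖g n t • φ (γ n t) - glim t • φ (γlim t)‖ₑ)
      atTop (nhds 0) := by
  have hmeas := fun n => (hφ.measurable.comp_aemeasurable (hγ n).aemeasurable)
  have hmeas_lim := hφ.measurable.comp_aemeasurable hγlim.aemeasurable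
  have hdiff : Tendsto (fun n => ∫⁻ t in Icc (0:ℝ) 1, ‖g n t - glim t‖ₑ * M) atTop (nhds 0) := by
    have h := ENNReal.Tendsto.mul_const (b := (M : ℝ≥0∞))
      (tendsto_lintegral_enorm_of_tendsto_intervalIntegral
        (fun n => (hγ n).2.1.sub hγlim.2.1) hconv) (Or.inr ENNReal.coe_ne_top)
    rw [zero_mul] at h
    refine h.congr fun n => ?_
    exact (lintegral_mul_const' _ _ ENNReal.coe_ne_top).symm
  have hcomp : Tendsto (fun n => ∫⁻ t in Icc (0:ℝ) 1, ‖glim t‖ₑ * ‖φ (γ n t) - φ (γlim t)‖ₑ)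
      atTop (nhds 0) := by
    have h := tendsto_lintegral_of_dominated_convergence' (μ := volume.restrict (Icc (0:ℝ) 1))
      (F := fun n t => ‖glim t‖ₑ * ‖φ (γ n t) - φ (γlim t)‖ₑ) (f := fun _ => 0)
      (fun t => ‖glim t‖ₑ * (M + M))
      (fun n => hγlim.1.measurable.enorm.aemeasurable.mul ((hmeas n).sub hmeas_lim).enorm)
      (fun n => ae_of_all _ fun t => by
        dsimp only
        gcongr
        exact enorm_sub_le.trans (add_le_add (hM _) (hM _)))
      (by
        rw [lintegral_mul_const' _ _ (by simp)]
        exact ENNReal.mul_ne_top hγlim.2.1.2.ne (by simp))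
      (by
        filter_upwards [ae_restrict_mem measurableSet_Icc] with t ht
        have h1 : Tendsto (fun n => φ (γ n t) - φ (γlim t)) atTop (nhds 0) := by
          have h2 := (hφ.tendsto _).comp (IsACDerivR.tendsto_apply hγ hγlim hconv ht)
          simpa using h2.sub_const (φ (γlim t))
        have h3 := ENNReal.Tendsto.const_mul (a := ‖glim t‖ₑ) h1.enorm (Or.inr enorm_ne_top)
        simpa using h3)
    simpa using h
  have hsum := hdiff.add hcomp
  rw [add_zero] at hsum
  refine tendsto_of_tendsto_of_tendsto_of_le_of_le tendsto_const_nhds hsum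
    (fun _ => zero_le) fun n => ?_
  have hgm : Measurable fun t => ‖g n t - glim t‖ₑ * (M : ℝ≥0∞) :=
    ((hγ n).1.measurable.sub hγlim.1.measurable).enorm.mul_const _
  dsimp only
  rw [← lintegral_add_left hgm]
  refine lintegral_mono fun t => ?_
  have hsplit : g n t • φ (γ n t) - glim t • φ (γlim t) =
      (g n t - glim t) • φ (γ n t) + glim t • (φ (γ n t) - φ (γlim t)) := by
    module
  rw [hsplit]
  refine (enorm_add_le _ _).trans ?_
  rw [enorm_smul, enorm_smul]
  gcongr
  exact hM _

theorem tendsto_lintegral_smul_comp {d : ℕ} {f : ℕ → ℝ → E d} {flim : ℝ → E d}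
    {γ g : ℕ → ℝ → ℝ} {γlim glim : ℝ → ℝ}
    (hf : ∀ n, Measurable (f n)) (hflim : Measurable flim)
    (hfi : ∀ n, IntegrableOn (f n) (Icc 0 1)) (hflimi : IntegrableOn flim (Icc 0 1))
    (hγ : ∀ n, IsACDerivR (γ n) (g n))
    (hγ0 : ∀ n, ∀ᵐ t ∂(volume.restrict (Icc (0:ℝ) 1)), 0 ≤ g n t)
    (hγ1 : ∀ n, γ n 1 = 1)
    (hγlim : IsACDerivR γlim glim)
    (hγlim0 : ∀ᵐ t ∂(volume.restrict (Icc (0:ℝ) 1)), 0 ≤ glim t)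
    (hγlim1 : γlim 1 = 1)
    (hfconv : Tendsto (fun n => ∫ t in (0:ℝ)..1, ‖f n t - flim t‖) atTop (nhds 0))
    (hγconv : Tendsto (fun n => ∫ t in (0:ℝ)..1, |g n t - glim t|) atTop (nhds 0)) :
    Tendsto (fun n => ∫⁻ t in Icc (0:ℝ) 1, ‖g n t • f n (γ n t) - glim t • flim (γlim t)‖ₑ)
      atTop (nhds 0) := by
  rw [ENNReal.tendsto_nhds_zero]
  intro ε hε
  have hε4 : ε / 4 ≠ 0 := (ENNReal.div_pos hε.ne' (by simp)).ne'
  obtain ⟨φ, hφc, hφε, hφ, -⟩ := Integrable.exists_hasCompactSupport_lintegral_sub_le hflimi hε4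
  obtain ⟨C, hC⟩ := hφc.exists_bound_of_continuous hφ
  have hM : ∀ x, ‖φ x‖ₑ ≤ (C.toNNReal : ℝ≥0∞) := fun x => by
    rw [← ofReal_norm]
    exact ENNReal.ofReal_le_ofReal (hC x)
  have hfconv' := tendsto_lintegral_enorm_of_tendsto_intervalIntegral
    (fun n => (hfi n).sub hflimi) hfconv
  have hφconv := tendsto_lintegral_smul_comp_of_bounded hγ hγlim hγconv hφ hM
  filter_upwards [ENNReal.tendsto_nhds_zero.1 hfconv' _ hε4.bot_lt,
    ENNReal.tendsto_nhds_zero.1 hφconv _ hε4.bot_lt] with n hn₁ hn₂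
  have hd₁ : Measurable fun t => f n t - flim t := (hf n).sub hflim
  have hd₂ : Measurable fun t => flim t - φ t := hflim.sub hφ.measurable
  have e₁ := (hγ n).lintegral_enorm_smul_comp (hγ0 n) (hγ1 n) hd₁
  have e₂ := (hγ n).lintegral_enorm_smul_comp (hγ0 n) (hγ1 n) hd₂
  have e₃ := hγlim.lintegral_enorm_smul_comp hγlim0 hγlim1 hd₂
  have m₁ := ((hγ n).aestronglyMeasurable_smul_comp hd₁).enorm
  have m₂ := ((hγ n).aestronglyMeasurable_smul_comp hd₂).enorm
  have m₃ := (hγlim.aestronglyMeasurable_smul_comp hd₂).enorm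
  calc ∫⁻ t in Icc (0:ℝ) 1, ‖g n t • f n (γ n t) - glim t • flim (γlim t)‖ₑ
      ≤ ∫⁻ t in Icc (0:ℝ) 1, (‖g n t • (f n (γ n t) - flim (γ n t))‖ₑ +
          (‖g n t • (flim (γ n t) - φ (γ n t))‖ₑ +
          (‖glim t • (flim (γlim t) - φ (γlim t))‖ₑ +
          ‖g n t • φ (γ n t) - glim t • φ (γlim t)‖ₑ))) := by
        refine lintegral_mono fun t => ?_
        have hsplit : g n t • f n (γ n t) - glim t • flim (γlim t) =
            g n t • (f n (γ n t) - flim (γ n t)) + (g n t • (flim (γ n t) - φ (γ n t)) +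
            (-(glim t • (flim (γlim t) - φ (γlim t))) +
            (g n t • φ (γ n t) - glim t • φ (γlim t)))) := by
          module
        rw [hsplit, ← enorm_neg (glim t • (flim (γlim t) - φ (γlim t)))]
        refine (enorm_add_le _ _).trans ?_
        gcongr
        refine (enorm_add_le _ _).trans ?_
        gcongr
        exact enorm_add_le _ _
    _ = (∫⁻ t in Icc (0:ℝ) 1, ‖f n t - flim t‖ₑ) + ((∫⁻ t in Icc (0:ℝ) 1, ‖flim t - φ t‖ₑ) +
          ((∫⁻ t in Icc (0:ℝ) 1, ‖flim t - φ t‖ₑ) +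
          ∫⁻ t in Icc (0:ℝ) 1, ‖g n t • φ (γ n t) - glim t • φ (γlim t)‖ₑ)) := by
        rw [lintegral_add_left' m₁, lintegral_add_left' m₂, lintegral_add_left' m₃, e₁, e₂, e₃]
    _ ≤ ε / 4 + (ε / 4 + (ε / 4 + ε / 4)) := by
        gcongr
        exact hn₁
    _ = ε := by
        rw [ENNReal.div_add_div_same, ENNReal.div_add_div_same, ENNReal.div_add_div_same,
          show ε + (ε + (ε + ε)) = ε * 4 by ring]
        exact ENNReal.mul_div_cancel_right (by simp) (by simp)

/-- the action of `Γ̄` on `AC₀([0,1],ℝ^d)` by composition is jointly continuous: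
if `cₙ → c` in the AC norm and `γₙ → γ` in `Γ̄`, then `cₙ ∘ γₙ → c ∘ γ` in the AC norm.
The AC distance of the compositions is expressed both through the chain-rule derivative
`(cₙ ∘ γₙ)' = γₙ' ⋅ (cₙ' ∘ γₙ)` and through arbitrary choices of a.e. derivatives. -/
theorem stmt_8 (d : ℕ) (c : ℕ → ℝ → E d) (f : ℕ → ℝ → E d) (clim flim : ℝ → E d)
    (γ : ℕ → ℝ → ℝ) (g : ℕ → ℝ → ℝ) (γlim : ℝ → ℝ) (glim : ℝ → ℝ)
    (hc : ∀ n, IsACDeriv (c n) (f n)) (hclim : IsACDeriv clim flim)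
    (hγ : ∀ n, IsACDerivR (γ n) (g n))
    (hγ0 : ∀ n, ∀ᵐ t ∂(volume.restrict (Icc (0:ℝ) 1)), 0 ≤ g n t)
    (hγ1 : ∀ n, γ n 1 = 1)
    (hγlim : IsACDerivR γlim glim)
    (hγlim0 : ∀ᵐ t ∂(volume.restrict (Icc (0:ℝ) 1)), 0 ≤ glim t)
    (hγlim1 : γlim 1 = 1)
    (hcconv : Tendsto (fun n => ∫ t in (0:ℝ)..1, ‖f n t - flim t‖) atTop (nhds 0))
    (hγconv : Tendsto (fun n => ∫ t in (0:ℝ)..1, |g n t - glim t|) atTop (nhds 0)) :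
    Tendsto (fun n => ∫ t in (0:ℝ)..1, ‖g n t • f n (γ n t) - glim t • flim (γlim t)‖)
      atTop (nhds 0) ∧
    ∀ (h : ℕ → ℝ → E d) (hlim : ℝ → E d),
      (∀ n, IsACDeriv (c n ∘ γ n) (h n)) → IsACDeriv (clim ∘ γlim) hlim →
      Tendsto (fun n => ∫ t in (0:ℝ)..1, ‖h n t - hlim t‖) atTop (nhds 0) := by
  have hchain : Tendsto (fun n => ∫ t in (0:ℝ)..1,
      ‖g n t • f n (γ n t) - glim t • flim (γlim t)‖) atTop (nhds 0) := by
    have h := (ENNReal.tendsto_toReal ENNReal.zero_ne_top).comp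
      (tendsto_lintegral_smul_comp (fun n => (hc n).1.measurable) hclim.1.measurable
        (fun n => (hc n).2.1) hclim.2.1 hγ hγ0 hγ1 hγlim hγlim0 hγlim1 hcconv hγconv)
    refine h.congr fun n => ?_
    exact (intervalIntegral_norm_eq_toReal
      (((hγ n).aestronglyMeasurable_smul_comp (hc n).1.measurable).sub
        (hγlim.aestronglyMeasurable_smul_comp hclim.1.measurable))).symm
  refine ⟨hchain, fun h hlim hh hhlim => hchain.congr fun n => ?_⟩
  rw [intervalIntegral.integral_of_le zero_le_one, intervalIntegral.integral_of_le zero_le_one,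
    ← integral_Icc_eq_integral_Ioc, ← integral_Icc_eq_integral_Ioc]
  refine integral_congr_ae ?_
  filter_upwards [(hh n).comp_ae_eq (hc n) (hγ n) (hγ0 n) (hγ1 n),
    hhlim.comp_ae_eq hclim hγlim hγlim0 hγlim1] with t h₁ h₂
  rw [h₁, h₂]
end
end

section
/- Let c ∈ AC_0([0,1],ℝ^d). (1) If c = b ∘ γ for some b ∈ AC_0([0,1],ℝ^d) with b' ≠ 0 a.e. and some γ ∈ Γ̄, then the closure in AC_0 of the orbit c ∘ Γ = { c ∘ γ : γ ∈ Γ } equals b ∘ Γ̄ = { b ∘ β : β ∈ Γ̄ }. (2) In particular, if c' ≠ 0 a.e., then the closure of c ∘ Γ equals c ∘ Γ̄. -/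
open MeasureTheory Set Filter
open scoped NNReal ENNReal

noncomputable section

/-- The AC norm `‖x‖_{AC} = ∫_0^1 ‖x'‖` of a curve `x ∈ AC₀([0,1],ℝ^d)` (and `0` if `x` is not
such a curve); well defined since the a.e. derivative is a.e. unique. -/
def ACnorm {d : ℕ} (x : ℝ → E d) : ℝ := by
  classical exact if h : ∃ f, IsACDeriv x f then ∫ t in (0:ℝ)..1, ‖h.choose t‖ else 0

/-- The orbit `c ∘ Γ̄` of a curve under the reparametrisation semigroup `Γ̄`
(curves are compared on `[0,1]`). -/
def OrbitBar {d : ℕ} (c : ℝ → E d) : Set (ℝ → E d) :=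
  {x | ∃ γ, MemGammaBar γ ∧ ∀ t ∈ Icc (0:ℝ) 1, x t = c (γ t)}

/-- The orbit `c ∘ Γ` of a curve under the reparametrisation group `Γ`. -/
def Orbit {d : ℕ} (c : ℝ → E d) : Set (ℝ → E d) :=
  {x | ∃ γ, MemGamma γ ∧ ∀ t ∈ Icc (0:ℝ) 1, x t = c (γ t)}

/-- The closure of a set of curves inside `AC₀([0,1],ℝ^d)` with respect to the AC norm. -/
def ACClosure {d : ℕ} (S : Set (ℝ → E d)) : Set (ℝ → E d) :=
  {x | (∃ f, IsACDeriv x f) ∧ ∀ ε > (0:ℝ), ∃ y ∈ S, ACnorm (x - y) < ε}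

theorem intervalIntegral_eq_setIntegral_Icc {F : Type*} [NormedAddCommGroup F] [NormedSpace ℝ F]
    (f : ℝ → F) {t : ℝ} (ht : 0 ≤ t) : ∫ τ in (0:ℝ)..t, f τ = ∫ τ in Icc 0 t, f τ := by
  rw [intervalIntegral.integral_of_le ht, integral_Icc_eq_integral_Ioc]

/-- A globally defined, continuous and monotone representative `γ` of an element of `Γ̄`, together
with an everywhere nonnegative measurable density `g`. -/
structure Repar (γ g : ℝ → ℝ) : Prop where
  meas : Measurable g
  nonneg : ∀ t, 0 ≤ g t
  int : IntegrableOn g (Icc 0 1)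
  cont : Continuous γ
  mono : Monotone γ
  mem : ∀ t, γ t ∈ Icc (0:ℝ) 1
  eq : ∀ t ∈ Icc (0:ℝ) 1, γ t = ∫ τ in Icc 0 t, g τ
  one : γ 1 = 1

theorem exists_repar {g : ℝ → ℝ} (hg : Measurable g) (h0 : ∀ t, 0 ≤ g t)
    (hi : IntegrableOn g (Icc 0 1)) (h1 : ∫ τ in Icc (0:ℝ) 1, g τ = 1) : ∃ γ, Repar γ g := by
  let p : ℝ → Icc (0:ℝ) 1 := projIcc (0:ℝ) 1 zero_le_one
  let G : ℝ → ℝ := fun t => ∫ τ in Icc 0 t, g τ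
  have hG : ContinuousOn G (Icc 0 1) := intervalIntegral.continuousOn_primitive_Icc hi
  have hmono : MonotoneOn G (Icc 0 1) := by
    intro s _ t ht hst
    exact setIntegral_mono_set (hi.mono_set (Icc_subset_Icc_right ht.2))
      (ae_of_all _ h0) (Icc_subset_Icc_right hst).eventuallyLE
  refine ⟨fun t => G (p t), hg, h0, hi, ?_, ?_, ?_, ?_, ?_⟩
  · exact hG.comp_continuous (continuous_subtype_val.comp continuous_projIcc) fun t => (p t).2
  · intro s t hst
    exact hmono (p s).2 (p t).2 (monotone_projIcc _ hst)
  · intro t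
    refine ⟨integral_nonneg h0, ?_⟩
    exact (hmono (p t).2 (right_mem_Icc.2 zero_le_one) (p t).2.2).trans_eq h1
  · intro t ht
    simp only [p, projIcc_of_mem zero_le_one ht, G]
  · simp only [p, projIcc_right, G, h1]

namespace Repar

variable {γ g : ℝ → ℝ}

theorem zero (h : Repar γ g) : γ 0 = 0 := by
  rw [h.eq 0 (by simp)]; simp

theorem isACDerivR (h : Repar γ g) : IsACDerivR γ g :=
  ⟨h.meas.stronglyMeasurable, h.int, fun t ht => by
    rw [h.eq t ht, intervalIntegral_eq_setIntegral_Icc _ ht.1]⟩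

theorem memGammaBar (h : Repar γ g) : MemGammaBar γ :=
  ⟨g, h.isACDerivR, ae_of_all _ h.nonneg, h.one⟩

theorem memGamma (h : Repar γ g) (hpos : ∀ t, 0 < g t) : MemGamma γ :=
  ⟨g, h.isACDerivR, ae_of_all _ hpos, h.one⟩

theorem integral_eq_one (h : Repar γ g) : ∫ τ in Icc (0:ℝ) 1, g τ = 1 := by
  rw [← h.eq 1 (by simp), h.one]

theorem lintegral_Icc (h : Repar γ g) {t : ℝ} (ht : t ∈ Icc (0:ℝ) 1) :
    ∫⁻ τ in Icc 0 t, ENNReal.ofReal (g τ) = ENNReal.ofReal (γ t) := by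
  rw [h.eq t ht, ofReal_integral_eq_lintegral_ofReal
    (h.int.mono_set (Icc_subset_Icc_right ht.2)) (ae_of_all _ h.nonneg)]

theorem setOf_le_eq_Icc (h : Repar γ g) {t : ℝ} (ht : t ∈ Icc (0:ℝ) 1) {a : ℝ} (ha : 0 ≤ a) :
    ∃ s ∈ Icc (0:ℝ) 1, γ ⁻¹' Iic a ∩ Icc 0 t = Icc 0 s ∧ γ s = min a (γ t) := by
  have hc : IsCompact (γ ⁻¹' Iic a ∩ Icc 0 t) :=
    isCompact_Icc.inter_left (isClosed_Iic.preimage h.cont)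
  obtain ⟨s, ⟨hsa, hst⟩, hs⟩ := hc.exists_isGreatest
    ⟨0, by simp [h.zero, ha], left_mem_Icc.2 ht.1⟩
  refine ⟨s, ⟨hst.1, hst.2.trans ht.2⟩, ?_, ?_⟩
  · ext τ
    constructor
    · intro hτ
      exact ⟨hτ.2.1, hs hτ⟩
    · intro hτ
      exact ⟨(h.mono hτ.2).trans hsa, hτ.1, hτ.2.trans hst.2⟩
  · refine le_antisymm (le_min hsa (h.mono hst.2)) ?_
    obtain ⟨u, hu, hua⟩ := intermediate_value_Icc ht.1 h.cont.continuousOn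
      (show min a (γ t) ∈ Icc (γ 0) (γ t) by
        rw [h.zero]; exact ⟨le_min ha (h.mem t).1, min_le_right _ _⟩)
    rw [← hua]
    exact h.mono (hs ⟨by simp [hua], hu⟩)

/-- Change of variables: `γ` pushes the measure `γ' dt` on `[0,t]` forward to Lebesgue measure
on `[0, γ t]`. -/
theorem map_withDensity (h : Repar γ g) {t : ℝ} (ht : t ∈ Icc (0:ℝ) 1) :
    Measure.map γ ((volume.restrict (Icc 0 t)).withDensity fun τ => ENNReal.ofReal (g τ)) =
      volume.restrict (Icc 0 (γ t)) := by
  have : IsFiniteMeasure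
      ((volume.restrict (Icc 0 t)).withDensity fun τ => ENNReal.ofReal (g τ)) :=
    ⟨by rw [withDensity_apply _ MeasurableSet.univ, Measure.restrict_univ, h.lintegral_Icc ht]
        exact ENNReal.ofReal_lt_top⟩
  refine Measure.ext_of_Iic _ _ fun a => ?_
  have hm : MeasurableSet (γ ⁻¹' Iic a) := h.cont.measurable measurableSet_Iic
  rw [Measure.map_apply h.cont.measurable measurableSet_Iic, withDensity_apply _ hm,
    Measure.restrict_restrict hm, Measure.restrict_apply measurableSet_Iic]
  rcases lt_or_ge a 0 with ha | ha
  · have h1 : γ ⁻¹' Iic a = ∅ := by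
      ext τ
      simpa using ha.trans_le (h.mem τ).1
    have h2 : Iic a ∩ Icc 0 (γ t) = ∅ := by
      ext τ
      simp only [mem_inter_iff, mem_Iic, mem_Icc, mem_empty_iff_false, iff_false]
      intro hτ
      linarith [hτ.1, hτ.2.1]
    simp [h1, h2]
  · obtain ⟨s, hs, hset, hsa⟩ := h.setOf_le_eq_Icc ht ha
    have h2 : Iic a ∩ Icc 0 (γ t) = Icc 0 (min a (γ t)) := by
      ext τ
      simp only [mem_inter_iff, mem_Iic, mem_Icc, le_min_iff]
      tauto
    rw [hset, h2, h.lintegral_Icc hs, hsa, Real.volume_Icc, sub_zero]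

section

variable {F : Type*} [NormedAddCommGroup F] [NormedSpace ℝ F] {f : ℝ → F}

theorem integrableOn_smul_comp (h : Repar γ g) (hf : IntegrableOn f (Icc 0 1)) :
    IntegrableOn (fun τ => g τ • f (γ τ)) (Icc 0 1) := by
  have h1 := h.map_withDensity (t := 1) (by simp)
  rw [h.one] at h1
  rw [IntegrableOn, ← h1] at hf
  have h2 := (integrable_withDensity_iff_integrable_smul' h.meas.ennreal_ofReal
    (by simp)).1 (hf.comp_measurable h.cont.measurable)
  refine h2.congr (ae_of_all _ fun τ => ?_)
  simp [ENNReal.toReal_ofReal (h.nonneg τ)]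

theorem setIntegral_smul_comp (h : Repar γ g) (hf : StronglyMeasurable f)
    {t : ℝ} (ht : t ∈ Icc (0:ℝ) 1) :
    ∫ τ in Icc 0 t, g τ • f (γ τ) = ∫ s in Icc 0 (γ t), f s := by
  rw [← h.map_withDensity ht, integral_map h.cont.measurable.aemeasurable
    hf.aestronglyMeasurable,
    integral_withDensity_eq_integral_toReal_smul h.meas.ennreal_ofReal (by simp)]
  exact integral_congr_ae (ae_of_all _ fun τ => by simp [ENNReal.toReal_ofReal (h.nonneg τ)])

end

theorem integral_smul_comp_eq {F : Type*} [NormedAddCommGroup F] [NormedSpace ℝ F] {f : ℝ → F}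
    (h : Repar γ g) (hf : StronglyMeasurable f) :
    ∫ τ in Icc 0 1, g τ • f (γ τ) = ∫ s in Icc 0 1, f s := by
  rw [h.setIntegral_smul_comp hf (by simp), h.one]

theorem isACDeriv_comp {d : ℕ} {c f : ℝ → E d} (h : Repar γ g) (hc : IsACDeriv c f) :
    IsACDeriv (fun t => c (γ t)) (fun τ => g τ • f (γ τ)) := by
  refine ⟨h.meas.stronglyMeasurable.smul (hc.1.comp_measurable h.cont.measurable),
    h.integrableOn_smul_comp hc.2.1, fun t ht => ?_⟩
  beta_reduce
  rw [hc.2.2 _ (h.mem t), intervalIntegral_eq_setIntegral_Icc _ ht.1,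
    intervalIntegral_eq_setIntegral_Icc _ (h.mem t).1, h.setIntegral_smul_comp hc.1 ht]

theorem comp {β k : ℝ → ℝ} (h : Repar γ g) (hβ : Repar β k) :
    Repar (fun t => γ (β t)) (fun t => k t * g (β t)) where
  meas := hβ.meas.mul (h.meas.comp hβ.cont.measurable)
  nonneg t := mul_nonneg (hβ.nonneg t) (h.nonneg _)
  int := hβ.integrableOn_smul_comp h.int
  cont := h.cont.comp hβ.cont
  mono := h.mono.comp hβ.mono
  mem t := h.mem _
  eq t ht := by
    rw [h.eq _ (hβ.mem t), ← hβ.setIntegral_smul_comp h.meas.stronglyMeasurable ht]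
    rfl
  one := by rw [hβ.one, h.one]

theorem strictMonoOn (h : Repar γ g) (hpos : ∀ t, 0 < g t) : StrictMonoOn γ (Icc 0 1) := by
  intro s hs t ht hst
  have hi : IntegrableOn g (Icc 0 t) := h.int.mono_set (Icc_subset_Icc_right ht.2)
  have hu : Icc 0 t = Icc 0 s ∪ Ioc s t := (Icc_union_Ioc_eq_Icc hs.1 hst.le).symm
  have hi1 : IntegrableOn g (Icc 0 s) := h.int.mono_set (Icc_subset_Icc_right hs.2)
  have hi2 : IntegrableOn g (Ioc s t) := hi.mono_set (hu ▸ subset_union_right)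
  have hd : Disjoint (Icc 0 s) (Ioc s t) :=
    Set.disjoint_left.2 fun x hx hx' => absurd hx.2 (not_le.2 hx'.1)
  rw [h.eq s hs, h.eq t ht, hu, setIntegral_union hd measurableSet_Ioc hi1 hi2]
  have : 0 < ∫ τ in Ioc s t, g τ := by
    rw [← intervalIntegral.integral_of_le hst.le]
    exact intervalIntegral.intervalIntegral_pos_of_pos
      ((intervalIntegrable_iff_integrableOn_Ioc_of_le hst.le).2 hi2) hpos hst
  linarith

theorem exists_inverse (h : Repar γ g) (hpos : ∀ t, 0 < g t) :
    ∃ φ, Repar φ (fun s => (g (φ s))⁻¹) ∧ (∀ s ∈ Icc (0:ℝ) 1, γ (φ s) = s) ∧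
      ∀ t ∈ Icc (0:ℝ) 1, φ (γ t) = t := by
  let e : Icc (0:ℝ) 1 → Icc (0:ℝ) 1 := fun t => ⟨γ t, h.mem t⟩
  have he : StrictMono e := fun s t hst => h.strictMonoOn hpos s.2 t.2 hst
  have hsurj : Function.Surjective e := by
    rintro ⟨s, hs⟩
    obtain ⟨t, ht, hts⟩ := intermediate_value_Icc zero_le_one h.cont.continuousOn
      (show s ∈ Icc (γ 0) (γ 1) by rwa [h.zero, h.one])
    exact ⟨⟨t, ht⟩, Subtype.ext hts⟩
  let o := he.orderIsoOfSurjective e hsurj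
  let φ : ℝ → ℝ := fun s => o.symm (projIcc 0 1 zero_le_one s)
  have hr : ∀ s ∈ Icc (0:ℝ) 1, γ (φ s) = s := by
    intro s hs
    have : γ (o.symm ⟨s, hs⟩) = s := congrArg Subtype.val (o.apply_symm_apply ⟨s, hs⟩)
    simpa only [φ, projIcc_of_mem zero_le_one hs] using this
  have hmem : ∀ s, φ s ∈ Icc (0:ℝ) 1 := fun s => (o.symm _).2
  have hl : ∀ t ∈ Icc (0:ℝ) 1, φ (γ t) = t := fun t ht =>
    (h.strictMonoOn hpos).injOn (hmem _) ht (hr _ (h.mem t))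
  have hcont : Continuous φ :=
    continuous_subtype_val.comp (o.symm.continuous.comp continuous_projIcc)
  have hkm : Measurable fun s => (g (φ s))⁻¹ := (h.meas.comp hcont.measurable).inv
  have hmono : Monotone φ := fun s t hst => o.symm.monotone (monotone_projIcc _ hst)
  have hone : φ 1 = 1 := by simpa only [h.one] using hl 1 (by simp)
  have hlint : ∀ s ∈ Icc (0:ℝ) 1,
      ∫⁻ σ in Icc 0 s, ENNReal.ofReal ((g (φ σ))⁻¹) = ENNReal.ofReal (φ s) := by
    intro s hs
    conv_lhs => rw [← hr s hs]
    rw [← h.map_withDensity (hmem s), lintegral_map hkm.ennreal_ofReal h.cont.measurable,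
      lintegral_withDensity_eq_lintegral_mul _ h.meas.ennreal_ofReal
        (show Measurable fun τ => ENNReal.ofReal ((g (φ (γ τ)))⁻¹) from
          (hkm.comp h.cont.measurable).ennreal_ofReal)]
    rw [setLIntegral_congr_fun (g := fun _ => 1) measurableSet_Icc]
    · simp
    · intro τ hτ
      have hτ' : τ ∈ Icc (0:ℝ) 1 := ⟨hτ.1, hτ.2.trans (hmem s).2⟩
      simp only [Pi.mul_apply, hl τ hτ']
      rw [← ENNReal.ofReal_mul (h.nonneg _), mul_inv_cancel₀ (hpos τ).ne', ENNReal.ofReal_one]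
  refine ⟨φ, ⟨hkm, fun t => inv_nonneg.2 (h.nonneg _), ?_, hcont, hmono,
    hmem, ?_, hone⟩, hr, hl⟩
  · refine ⟨hkm.aestronglyMeasurable, ?_⟩
    rw [hasFiniteIntegral_iff_ofReal (ae_of_all _ fun t => inv_nonneg.2 (h.nonneg _)),
      hlint 1 (by simp)]
    exact ENNReal.ofReal_lt_top
  · intro s hs
    rw [integral_eq_lintegral_of_nonneg_ae (ae_of_all _ fun t => inv_nonneg.2 (h.nonneg _))
      hkm.aestronglyMeasurable, hlint s hs, ENNReal.toReal_ofReal (hmem s).1]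

end Repar

theorem MemGammaBar.exists_repar {γ : ℝ → ℝ} (h : MemGammaBar γ) :
    ∃ β g, Repar β g ∧ EqOn γ β (Icc 0 1) := by
  obtain ⟨g, ⟨hm, hi, he⟩, h0, h1⟩ := h
  have hae : (fun t => max (g t) 0) =ᵐ[volume.restrict (Icc (0:ℝ) 1)] g := by
    filter_upwards [h0] with t ht using max_eq_left ht
  have hset : ∀ t ∈ Icc (0:ℝ) 1, γ t = ∫ τ in Icc 0 t, max (g τ) 0 := by
    intro t ht
    rw [he t ht, intervalIntegral_eq_setIntegral_Icc _ ht.1]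
    exact (integral_congr_ae (ae_restrict_of_ae_restrict_of_subset
      (Icc_subset_Icc_right ht.2) hae)).symm
  obtain ⟨β, hβ⟩ := _root_.exists_repar (hm.measurable.max measurable_const)
    (fun t => le_max_right _ _) (hi.congr hae.symm) (by rw [← hset 1 (by simp), h1])
  exact ⟨β, _, hβ, fun t ht => by rw [hset t ht, hβ.eq t ht]⟩

theorem MemGamma.exists_repar {γ : ℝ → ℝ} (h : MemGamma γ) :
    ∃ β g, Repar β g ∧ EqOn γ β (Icc 0 1) := by
  obtain ⟨g, hg, h0, h1⟩ := h
  exact MemGammaBar.exists_repar ⟨g, hg, h0.mono fun t ht => ht.le, h1⟩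

section ACnorm

variable {d : ℕ} {x y f g : ℝ → E d}

theorem IsACDeriv.sub (hx : IsACDeriv x f) (hy : IsACDeriv y g) :
    IsACDeriv (x - y) (f - g) := by
  refine ⟨hx.1.sub hy.1, hx.2.1.sub hy.2.1, fun t ht => ?_⟩
  have hs : Icc 0 t ⊆ Icc (0:ℝ) 1 := Icc_subset_Icc_right ht.2
  rw [Pi.sub_apply, hx.2.2 t ht, hy.2.2 t ht, intervalIntegral_eq_setIntegral_Icc _ ht.1,
    intervalIntegral_eq_setIntegral_Icc _ ht.1, intervalIntegral_eq_setIntegral_Icc _ ht.1]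
  exact (integral_sub (hx.2.1.mono_set hs) (hy.2.1.mono_set hs)).symm

theorem IsACDeriv.congr (hx : IsACDeriv x f) (h : EqOn x y (Icc 0 1)) : IsACDeriv y f :=
  ⟨hx.1, hx.2.1, fun t ht => by rw [← h ht, hx.2.2 t ht]⟩

theorem IsACDeriv.norm_le (hx : IsACDeriv x f) {t : ℝ} (ht : t ∈ Icc (0:ℝ) 1) :
    ‖x t‖ ≤ ∫ τ in Icc (0:ℝ) 1, ‖f τ‖ := by
  rw [hx.2.2 t ht, intervalIntegral_eq_setIntegral_Icc _ ht.1]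
  exact (norm_integral_le_integral_norm _).trans <|
    setIntegral_mono_set hx.2.1.norm (ae_of_all _ fun _ => norm_nonneg _)
      (Icc_subset_Icc_right ht.2).eventuallyLE

theorem IsACDeriv.ae_eq (hf : IsACDeriv x f) (hg : IsACDeriv x g) :
    f =ᵐ[volume.restrict (Icc 0 1)] g := by
  have hI : ∀ {f}, IsACDeriv x f → IntervalIntegrable f volume 0 1 := fun hf =>
    (intervalIntegrable_iff_integrableOn_Icc_of_le zero_le_one).2 hf.2.1
  have h01 : uIcc (0:ℝ) 1 = Icc 0 1 := uIcc_of_le zero_le_one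
  rw [← restrict_Ioo_eq_restrict_Icc, EventuallyEq, ae_restrict_iff' measurableSet_Ioo]
  filter_upwards [(hI hf).ae_hasDerivAt_integral, (hI hg).ae_hasDerivAt_integral]
    with t h1 h2 ht
  have ht' : t ∈ uIcc (0:ℝ) 1 := h01 ▸ Ioo_subset_Icc_self ht
  refine (h1 ht' 0 left_mem_uIcc).unique ((h2 ht' 0 left_mem_uIcc).congr_of_eventuallyEq ?_)
  filter_upwards [Icc_mem_nhds ht.1 ht.2] with s hs
  rw [← hf.2.2 s hs, ← hg.2.2 s hs]

theorem IsACDeriv.ACnorm_eq (hf : IsACDeriv x f) :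
    ACnorm x = ∫ t in Icc (0:ℝ) 1, ‖f t‖ := by
  have h : ∃ f, IsACDeriv x f := ⟨f, hf⟩
  rw [ACnorm, dif_pos h, intervalIntegral_eq_setIntegral_Icc _ zero_le_one]
  exact integral_congr_ae ((h.choose_spec.ae_eq hf).mono fun t ht => by simp only [ht])

end ACnorm

namespace Repar

variable {γ g β k : ℝ → ℝ}

theorem dist_le (hγ : Repar γ g) (hβ : Repar β k) {t : ℝ} (ht : t ∈ Icc (0:ℝ) 1) :
    dist (γ t) (β t) ≤ ∫ τ in Icc (0:ℝ) 1, |g τ - k τ| := by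
  have hs : Icc 0 t ⊆ Icc (0:ℝ) 1 := Icc_subset_Icc_right ht.2
  rw [hγ.eq t ht, hβ.eq t ht, Real.dist_eq,
    ← integral_sub (hγ.int.mono_set hs) (hβ.int.mono_set hs)]
  exact (abs_integral_le_integral_abs).trans <|
    setIntegral_mono_set (hγ.int.sub hβ.int).abs (ae_of_all _ fun _ => abs_nonneg _)
      hs.eventuallyLE

theorem integral_norm_smul_comp_sub {F : Type*} [NormedAddCommGroup F] [NormedSpace ℝ F]
    {f f' : ℝ → F} (h : Repar γ g) (hf : StronglyMeasurable f) (hf' : StronglyMeasurable f') :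
    ∫ τ in Icc (0:ℝ) 1, ‖g τ • f (γ τ) - g τ • f' (γ τ)‖ =
      ∫ s in Icc (0:ℝ) 1, ‖f s - f' s‖ := by
  rw [← h.integral_smul_comp_eq (f := fun s => ‖f s - f' s‖) (hf.sub hf').norm]
  refine integral_congr_ae (ae_of_all _ fun τ => ?_)
  simp only [← smul_sub, norm_smul, Real.norm_of_nonneg (h.nonneg τ), smul_eq_mul]

/-- Composition with a fixed absolutely continuous curve is continuous on `Γ̄`. -/
theorem exists_integral_smul_comp_sub_lt {F : Type*} [NormedAddCommGroup F] [NormedSpace ℝ F]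
    {f : ℝ → F} (hf : StronglyMeasurable f) (hfi : IntegrableOn f (Icc 0 1))
    {ε : ℝ} (hε : 0 < ε) :
    ∃ δ > 0, ∀ {γ g β k : ℝ → ℝ}, Repar γ g → Repar β k →
      ∫ τ in Icc (0:ℝ) 1, |g τ - k τ| < δ →
      ∫ τ in Icc (0:ℝ) 1, ‖g τ • f (γ τ) - k τ • f (β τ)‖ < ε := by
  obtain ⟨u, hus, hu, huc, -⟩ := hfi.exists_hasCompactSupport_integral_sub_le
    (show 0 < ε / 5 by positivity)
  obtain ⟨M, hM⟩ := huc.bounded_above_of_compact_support hus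
  have hM0 : 0 ≤ M := (norm_nonneg _).trans (hM 0)
  obtain ⟨δ, hδ, hδu⟩ := Metric.uniformContinuous_iff.1
    (hus.uniformContinuous_of_continuous huc) (ε / 5) (by positivity)
  refine ⟨min δ (ε / 5 / (M + 1)), by positivity, fun {γ g β k} hγ hβ hlt => ?_⟩
  have hum : StronglyMeasurable u := huc.stronglyMeasurable_of_hasCompactSupport hus
  have hui : IntegrableOn u (Icc 0 1) := huc.integrableOn_Icc
  have i1 : IntegrableOn (fun τ => ‖g τ • f (γ τ) - g τ • u (γ τ)‖) (Icc 0 1) :=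
    ((hγ.integrableOn_smul_comp hfi).sub (hγ.integrableOn_smul_comp hui)).norm
  have i2 : IntegrableOn (fun τ => g τ * (ε / 5)) (Icc 0 1) := hγ.int.mul_const _
  have i3 : IntegrableOn (fun τ => |g τ - k τ| * M) (Icc 0 1) :=
    (hγ.int.sub hβ.int).abs.mul_const _
  have i4 : IntegrableOn (fun τ => ‖k τ • f (β τ) - k τ • u (β τ)‖) (Icc 0 1) :=
    ((hβ.integrableOn_smul_comp hfi).sub (hβ.integrableOn_smul_comp hui)).norm
  have e1 := (hγ.integral_norm_smul_comp_sub hf hum).trans_le hu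
  have e4 := (hβ.integral_norm_smul_comp_sub hf hum).trans_le hu
  have e2 : ∫ τ in Icc (0:ℝ) 1, g τ * (ε / 5) = ε / 5 := by
    rw [integral_mul_const, hγ.integral_eq_one, one_mul]
  have e3 : ∫ τ in Icc (0:ℝ) 1, |g τ - k τ| * M ≤ ε / 5 := by
    rw [integral_mul_const]
    have := (hlt.trans_le (min_le_right _ _)).le
    have h2 := mul_le_mul this (le_add_of_nonneg_right zero_le_one : M ≤ M + 1) hM0
      (by positivity)
    rwa [div_mul_cancel₀ _ (by positivity)] at h2
  have key : ∫ τ in Icc (0:ℝ) 1, ‖g τ • f (γ τ) - k τ • f (β τ)‖ ≤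
      ∫ τ in Icc (0:ℝ) 1, ((‖g τ • f (γ τ) - g τ • u (γ τ)‖ + g τ * (ε / 5)) +
        (|g τ - k τ| * M + ‖k τ • f (β τ) - k τ • u (β τ)‖)) := by
    refine setIntegral_mono_on
      ((hγ.integrableOn_smul_comp hfi).sub (hβ.integrableOn_smul_comp hfi)).norm
      ((i1.add i2).add (i3.add i4)) measurableSet_Icc fun τ hτ => ?_
    have hd : dist (γ τ) (β τ) < δ :=
      (hγ.dist_le hβ hτ).trans_lt (hlt.trans_le (min_le_left _ _))
    have hsplit : g τ • f (γ τ) - k τ • f (β τ) =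
        ((g τ • f (γ τ) - g τ • u (γ τ)) + g τ • (u (γ τ) - u (β τ))) +
          ((g τ - k τ) • u (β τ) - (k τ • f (β τ) - k τ • u (β τ))) := by
      rw [smul_sub, sub_smul]; abel
    rw [hsplit]
    refine (norm_add_le _ _).trans (add_le_add ((norm_add_le _ _).trans ?_)
      ((norm_sub_le _ _).trans ?_))
    · rw [norm_smul, Real.norm_of_nonneg (hγ.nonneg τ), ← dist_eq_norm (u (γ τ))]
      gcongr
      · exact hγ.nonneg τ
      · exact (hδu hd).le
    · rw [norm_smul, Real.norm_eq_abs]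
      gcongr
      exact hM _
  have hsum : ∫ τ in Icc (0:ℝ) 1, ((‖g τ • f (γ τ) - g τ • u (γ τ)‖ + g τ * (ε / 5)) +
        (|g τ - k τ| * M + ‖k τ • f (β τ) - k τ • u (β τ)‖)) =
      ((∫ τ in Icc (0:ℝ) 1, ‖g τ • f (γ τ) - g τ • u (γ τ)‖) +
        ∫ τ in Icc (0:ℝ) 1, g τ * (ε / 5)) +
      ((∫ τ in Icc (0:ℝ) 1, |g τ - k τ| * M) +
        ∫ τ in Icc (0:ℝ) 1, ‖k τ • f (β τ) - k τ • u (β τ)‖) := by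
    rw [← integral_add i1 i2, ← integral_add i3 i4]
    exact integral_add (i1.add i2) (i3.add i4)
  linarith

/-- Elements of `Γ` are dense in `Γ̄`. -/
theorem exists_pos_near (h : Repar γ g) {ε : ℝ} (hε : 0 < ε) :
    ∃ β k, Repar β k ∧ (∀ t, 0 < k t) ∧ ∫ τ in Icc (0:ℝ) 1, |g τ - k τ| < ε := by
  let s : ℝ := min 1 (ε / 3)
  have hs : 0 < s := by positivity
  have hs1 : s ≤ 1 := min_le_left _ _
  have hs2 : s ≤ ε / 3 := min_le_right _ _
  have ic : IntegrableOn (fun _ : ℝ => s) (Icc (0:ℝ) 1) := integrableOn_const (by simp)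
  have i1 : IntegrableOn (fun τ => (1 - s) * g τ) (Icc (0:ℝ) 1) := h.int.const_mul _
  have hpos : ∀ t, 0 < (1 - s) * g t + s := fun t =>
    add_pos_of_nonneg_of_pos (mul_nonneg (sub_nonneg.2 hs1) (h.nonneg t)) hs
  obtain ⟨β, hβ⟩ := exists_repar (g := fun t => (1 - s) * g t + s)
    ((h.meas.const_mul _).add_const _) (fun t => (hpos t).le) (i1.add ic)
    (by rw [integral_add i1 ic, integral_const_mul, h.integral_eq_one]; simp)
  refine ⟨β, _, hβ, hpos, ?_⟩
  have i2 : IntegrableOn (fun τ => s * g τ) (Icc (0:ℝ) 1) := h.int.const_mul _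
  have : ∫ τ in Icc (0:ℝ) 1, |g τ - ((1 - s) * g τ + s)| ≤
      ∫ τ in Icc (0:ℝ) 1, (s * g τ + s) := by
    refine integral_mono (h.int.sub hβ.int).abs (i2.add ic) fun τ => ?_
    have := mul_nonneg hs.le (h.nonneg τ)
    exact abs_le.2 ⟨by linarith, by linarith⟩
  rw [integral_add i2 ic, integral_const_mul, h.integral_eq_one] at this
  simp only [mul_one, integral_const, measureReal_restrict_apply_univ, Real.volume_real_Icc,
    sub_zero, smul_eq_mul, zero_le_one, sup_of_le_left, one_mul] at this
  linarith

end Repar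

theorem IsACDeriv.continuousOn {d : ℕ} {x f : ℝ → E d} (h : IsACDeriv x f) :
    ContinuousOn x (Icc 0 1) :=
  (intervalIntegral.continuousOn_primitive_Icc h.2.1).congr fun t ht => by
    rw [h.2.2 t ht, intervalIntegral_eq_setIntegral_Icc _ ht.1]

theorem mem_orbitBar_iff {d : ℕ} {b x : ℝ → E d} :
    x ∈ OrbitBar b ↔ ∃ γ g, Repar γ g ∧ EqOn x (fun t => b (γ t)) (Icc 0 1) := by
  constructor
  · rintro ⟨γ, hγ, hx⟩
    obtain ⟨β, g, hβ, he⟩ := hγ.exists_repar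
    exact ⟨β, g, hβ, fun t ht => by rw [hx t ht, he ht]⟩
  · rintro ⟨γ, g, hγ, hx⟩
    exact ⟨γ, hγ.memGammaBar, hx⟩

/-- Normalised arclength is an element of `Γ` when the speed is a.e. nonzero. -/
theorem exists_arclength {F : Type*} [NormedAddCommGroup F] {f : ℝ → F}
    (hf : StronglyMeasurable f) (hfi : IntegrableOn f (Icc 0 1))
    (h0 : ∀ᵐ t ∂(volume.restrict (Icc (0:ℝ) 1)), f t ≠ 0) :
    ∃ L > 0, ∃ ℓ p, Repar ℓ p ∧ (∀ t, 0 < p t) ∧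
      p =ᵐ[volume.restrict (Icc 0 1)] fun t => ‖f t‖ / L := by
  have hL : 0 < ∫ t in Icc (0:ℝ) 1, ‖f t‖ := by
    rw [integral_pos_iff_support_of_nonneg (fun t => norm_nonneg _) hfi.norm,
      pos_iff_ne_zero]
    intro hz
    have h1 : ∀ᵐ t ∂(volume.restrict (Icc (0:ℝ) 1)), t ∉ Function.support fun t => ‖f t‖ :=
      measure_eq_zero_iff_ae_notMem.1 hz
    have : NeBot (ae (volume.restrict (Icc (0:ℝ) 1))) :=
      ae_neBot.2 (Measure.restrict_eq_zero.not.2 (by simp))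
    obtain ⟨t, ht, ht'⟩ := (h0.and h1).exists
    exact ht' (norm_ne_zero_iff.2 ht)
  let L := ∫ t in Icc (0:ℝ) 1, ‖f t‖
  let p : ℝ → ℝ := fun t => if ‖f t‖ = 0 then 1 else ‖f t‖ / L
  have hpos : ∀ t, 0 < p t := by
    intro t
    by_cases h : ‖f t‖ = 0
    · simp [p, h]
    · simp only [p, h, if_false]
      exact div_pos ((norm_nonneg _).lt_of_ne' h) hL
  have hae : p =ᵐ[volume.restrict (Icc 0 1)] fun t => ‖f t‖ / L := by
    filter_upwards [h0] with t ht
    simp [p, ht]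
  have hm : Measurable fun t => ‖f t‖ := hf.norm.measurable
  obtain ⟨ℓ, hℓ⟩ := exists_repar (g := p)
    (Measurable.ite (hm (measurableSet_singleton 0)) measurable_const (hm.div_const _))
    (fun t => (hpos t).le)
    (Integrable.congr (hfi.norm.div_const L) hae.symm)
    (by rw [integral_congr_ae hae, integral_div]; exact div_self hL.ne')
  exact ⟨L, hL, ℓ, p, hℓ, hpos, hae⟩

theorem orbitBar_subset_closure_orbit {d : ℕ} {b c fb : ℝ → E d} (hb : IsACDeriv b fb)
    (hc : c ∈ OrbitBar b) : OrbitBar b ⊆ ACClosure (Orbit c) := by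
  intro x hx
  obtain ⟨γ, g, hγ, hcγ⟩ := mem_orbitBar_iff.1 hc
  obtain ⟨β, k, hβ, hxβ⟩ := mem_orbitBar_iff.1 hx
  have hx' := (hβ.isACDeriv_comp hb).congr hxβ.symm
  refine ⟨⟨_, hx'⟩, fun ε hε => ?_⟩
  obtain ⟨δ, hδ, hcont⟩ := Repar.exists_integral_smul_comp_sub_lt hb.1 hb.2.1 hε
  obtain ⟨γ₁, g₁, hγ₁, hg₁, hγγ₁⟩ := hγ.exists_pos_near (half_pos hδ)
  obtain ⟨β₁, k₁, hβ₁, hk₁, hββ₁⟩ := hβ.exists_pos_near (half_pos hδ)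
  obtain ⟨φ, hφ, -, -⟩ := hγ₁.exists_inverse hg₁
  have hψ := hφ.comp hβ₁
  have hγψ := hγ.comp hψ
  have hy : IsACDeriv (fun t => c (φ (β₁ t))) _ :=
    (hγψ.isACDeriv_comp hb).congr fun t _ => (hcγ (hφ.mem _)).symm
  refine ⟨_, ⟨_, hψ.memGamma fun t => mul_pos (hk₁ t) (inv_pos.2 (hg₁ _)), fun t _ => rfl⟩, ?_⟩
  rw [(hx'.sub hy).ACnorm_eq]
  refine hcont hβ hγψ ?_
  have e := hψ.integral_norm_smul_comp_sub hγ.meas.stronglyMeasurable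
    hγ₁.meas.stronglyMeasurable
  have i1 : IntegrableOn (fun t => |k t - k₁ t|) (Icc 0 1) := (hβ.int.sub hβ₁.int).abs
  have i2 := ((hψ.integrableOn_smul_comp hγ.int).sub (hψ.integrableOn_smul_comp hγ₁.int)).norm
  refine (integral_mono (hβ.int.sub hγψ.int).abs (i1.add i2) fun t => ?_).trans_lt ?_
  · have hc : k₁ t * (g₁ (φ (β₁ t)))⁻¹ * g₁ (φ (β₁ t)) = k₁ t :=
      inv_mul_cancel_right₀ (hg₁ _).ne' _
    simp only [Pi.sub_apply, Pi.add_apply, smul_eq_mul, hc, Real.norm_eq_abs]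
    rw [abs_sub_comm (k₁ t * _ * _) (k₁ t)]
    exact abs_sub_le (k t) (k₁ t) (k₁ t * (g₁ (φ (β₁ t)))⁻¹ * g (φ (β₁ t)))
  · rw [integral_add' i1 i2]
    simp only [Pi.sub_apply, smul_eq_mul, Real.norm_eq_abs] at e hγγ₁ ⊢
    linarith

/-- If the arclength element of `x` is close to that of `b ∘ β`, so are the primitives. -/
theorem Repar.abs_primitive_norm_sub_le {d : ℕ} {b fb f : ℝ → E d} {ℓ p β k : ℝ → ℝ} {L : ℝ}
    (hb : IsACDeriv b fb) (hf : IntegrableOn f (Icc 0 1)) (hL : 0 < L) (hℓ : Repar ℓ p)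
    (hp : p =ᵐ[volume.restrict (Icc 0 1)] fun t => ‖fb t‖ / L) (hβ : Repar β k)
    {t : ℝ} (ht : t ∈ Icc (0:ℝ) 1) :
    |ℓ (β t) - ∫ τ in Icc 0 t, ‖f τ‖ / L| ≤
      (∫ τ in Icc (0:ℝ) 1, ‖f τ - k τ • fb (β τ)‖) / L := by
  have hs : Icc 0 t ⊆ Icc (0:ℝ) 1 := Icc_subset_Icc_right ht.2
  have hi := hβ.integrableOn_smul_comp hb.2.1
  have hn : ∀ τ, k τ • (‖fb (β τ)‖ / L) = ‖k τ • fb (β τ)‖ / L := fun τ => by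
    rw [norm_smul, Real.norm_of_nonneg (hβ.nonneg τ), smul_eq_mul, mul_div_assoc]
  have i1 : IntegrableOn (fun τ => ‖k τ • fb (β τ)‖ / L) (Icc 0 1) := hi.norm.div_const L
  have i2 : IntegrableOn (fun τ => ‖f τ‖ / L) (Icc 0 1) := hf.norm.div_const L
  have h1 : ℓ (β t) = ∫ τ in Icc 0 t, ‖k τ • fb (β τ)‖ / L := by
    rw [hℓ.eq _ (hβ.mem t), integral_congr_ae (ae_restrict_of_ae_restrict_of_subset
      (Icc_subset_Icc_right (hβ.mem t).2) hp),
      ← hβ.setIntegral_smul_comp (hb.1.norm.measurable.div_const L).stronglyMeasurable ht]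
    simp only [hn]
  rw [h1, ← integral_sub (i1.mono_set hs) (i2.mono_set hs),
    ← integral_div]
  refine abs_integral_le_integral_abs.trans
    ((setIntegral_mono_set (i1.sub i2).abs
      (ae_of_all _ fun _ => abs_nonneg _) hs.eventuallyLE).trans ?_)
  refine integral_mono (i1.sub i2).abs
    ((hf.sub hi).norm.div_const L) fun τ => ?_
  simp only [Pi.sub_apply]
  rw [← sub_div, abs_div, abs_of_pos hL, norm_sub_rev]
  gcongr
  exact abs_norm_sub_norm_le _ _

theorem closure_orbit_subset_orbitBar {d : ℕ} {b c fb : ℝ → E d} (hb : IsACDeriv b fb)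
    (h0 : ∀ᵐ t ∂(volume.restrict (Icc (0:ℝ) 1)), fb t ≠ 0)
    (hc : c ∈ OrbitBar b) : ACClosure (Orbit c) ⊆ OrbitBar b := by
  rintro x ⟨⟨f, hf⟩, hx⟩
  obtain ⟨γ, g, hγ, hcγ⟩ := mem_orbitBar_iff.1 hc
  obtain ⟨L, hL, ℓ, p, hℓ, hp, hpL⟩ := exists_arclength hb.1 hb.2.1 h0
  obtain ⟨φ, hφ, -, hφℓ⟩ := hℓ.exists_inverse hp
  have happrox : ∀ n : ℕ, ∃ β k, Repar β k ∧
      ∫ τ in Icc (0:ℝ) 1, ‖f τ - k τ • fb (β τ)‖ < 1 / ((n:ℝ) + 1) ∧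
      ∀ t ∈ Icc (0:ℝ) 1, ‖x t - b (β t)‖ ≤ 1 / ((n:ℝ) + 1) := by
    intro n
    obtain ⟨y, ⟨ψ₀, hψ₀, hy⟩, hlt⟩ := hx (1 / ((n:ℝ) + 1)) Nat.one_div_pos_of_nat
    obtain ⟨ψ, q, hψ, he⟩ := hψ₀.exists_repar
    have hβ := hγ.comp hψ
    have hyb : EqOn (fun t => b (γ (ψ t))) y (Icc 0 1) := fun t ht => by
      rw [hy t ht, he ht, hcγ (hψ.mem t)]
    have hxy := hf.sub ((hβ.isACDeriv_comp hb).congr hyb)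
    rw [hxy.ACnorm_eq] at hlt
    refine ⟨_, _, hβ, hlt, fun t ht => ?_⟩
    have := (hxy.norm_le ht).trans hlt.le
    rwa [Pi.sub_apply, ← hyb ht] at this
  choose β k hβ hfk hxβ using happrox
  have hlim : ∀ t ∈ Icc (0:ℝ) 1,
      Tendsto (fun n => ℓ (β n t)) atTop (nhds (∫ τ in Icc 0 t, ‖f τ‖ / L)) := by
    intro t ht
    rw [tendsto_iff_dist_tendsto_zero]
    refine squeeze_zero (fun _ => dist_nonneg) (fun n => ?_)
      (by simpa only [zero_div] using
        tendsto_one_div_add_atTop_nhds_zero_nat.div_const L)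
    exact (Repar.abs_primitive_norm_sub_le hb hf.2.1 hL hℓ hpL (hβ n) ht).trans
      (div_le_div_of_nonneg_right (hfk n).le hL.le)
  have hone : ∫ τ in Icc (0:ℝ) 1, ‖f τ‖ / L = 1 := by
    refine tendsto_nhds_unique (hlim 1 (by simp)) ?_
    simp only [(hβ _).one, hℓ.one, tendsto_const_nhds]
  obtain ⟨σ, hσ⟩ := exists_repar (hf.1.norm.measurable.div_const L)
    (fun t => div_nonneg (norm_nonneg _) hL.le) (hf.2.1.norm.div_const L) hone
  refine mem_orbitBar_iff.2 ⟨_, _, hφ.comp hσ, fun t ht => ?_⟩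
  have h1 : Tendsto (fun n => β n t) atTop (nhds (φ (σ t))) := by
    rw [hσ.eq t ht]
    exact ((hφ.cont.tendsto _).comp (hlim t ht)).congr fun n => hφℓ _ ((hβ n).mem t)
  have h2 : Tendsto (fun n => b (β n t)) atTop (nhds (b (φ (σ t)))) :=
    (hb.continuousOn _ (hφ.mem _)).tendsto.comp
      (tendsto_nhdsWithin_iff.2 ⟨h1, Eventually.of_forall fun n => (hβ n).mem t⟩)
  refine tendsto_nhds_unique ?_ h2
  rw [tendsto_iff_norm_sub_tendsto_zero]
  refine squeeze_zero (fun _ => norm_nonneg _) (fun n => ?_)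
    tendsto_one_div_add_atTop_nhds_zero_nat
  rw [norm_sub_rev]
  exact hxβ n t ht

theorem memGammaBar_id : MemGammaBar id :=
  ⟨fun _ => 1, ⟨stronglyMeasurable_const, integrableOn_const (by simp), fun t _ => by simp⟩,
    ae_of_all _ fun _ => zero_le_one, rfl⟩

/-- (1) if `c = b ∘ γ` for some `b ∈ AC₀([0,1],ℝ^d)` with `b' ≠ 0` a.e. and some
`γ ∈ Γ̄`, then the AC closure of the orbit `c ∘ Γ` equals `b ∘ Γ̄`; (2) in particular, if
`c' ≠ 0` a.e. then the AC closure of `c ∘ Γ` equals `c ∘ Γ̄`. -/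
theorem stmt_11 (d : ℕ) :
    (∀ (b c : ℝ → E d) (fb : ℝ → E d), IsACDeriv b fb →
      (∀ᵐ t ∂(volume.restrict (Icc (0:ℝ) 1)), fb t ≠ 0) →
      c ∈ OrbitBar b →
      ACClosure (Orbit c) = OrbitBar b) ∧
    (∀ (c : ℝ → E d) (fc : ℝ → E d), IsACDeriv c fc →
      (∀ᵐ t ∂(volume.restrict (Icc (0:ℝ) 1)), fc t ≠ 0) →
      ACClosure (Orbit c) = OrbitBar c) := by
 
  have main : ∀ (b c : ℝ → E d) (fb : ℝ → E d), IsACDeriv b fb →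
      (∀ᵐ t ∂(volume.restrict (Icc (0:ℝ) 1)), fb t ≠ 0) →
      c ∈ OrbitBar b → ACClosure (Orbit c) = OrbitBar b := fun b c fb hb h0 hc =>
    (closure_orbit_subset_orbitBar hb h0 hc).antisymm (orbitBar_subset_closure_orbit hb hc)
  exact ⟨main, fun c fc hc h0 => main c c fc hc h0 ⟨id, memGammaBar_id, fun _ _ => rfl⟩⟩
end
end
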